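/- arXiv:2310.15471 — 6 statements merged into one kernel-verified Lean document; each statement's English description precedes it below -/
import Mathlib

section
/- Theorem 1 (multi-path response time bound). Let G = (V, E) be a DAG task with weight function c, let m ≥ 1 be an integer number of cores, and let (P_i)_{i=0}^{k} be a generalized path list with 0 ≤ k ≤ m − 1. Then for every execution sequence of G on m cores, the response time satisfies R ≤ min_{0 ≤ j ≤ k} [ len(G) + (vol(G) − Σ_{i=0}^{j} len(P_i)) / (m − j) ]. -/
/-!
STATEMENT 0: Theorem 1 (multi-path response time bound).
-/

noncomputable section

variable {V : Type*}

/-- `P` is a generalized path: its elements are pairwise comparable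
under the ancestor relation (the transitive closure of the edge relation `E`). -/
def IsGenPath (E : V → V → Prop) (P : Finset V) : Prop :=
  ∀ u ∈ P, ∀ v ∈ P, u ≠ v → Relation.TransGen E u v ∨ Relation.TransGen E v u

/-- The length of a (generalized) path: total weight of its vertices. -/
def pathLen (c : V → ℝ) (P : Finset V) : ℝ := ∑ v ∈ P, c v

/-- The volume of the DAG: total weight of all vertices. -/
def dagVol [Fintype V] (c : V → ℝ) : ℝ := ∑ v : V, c v

/-- `len(G)`: the maximum length of a generalized path of the DAG. -/
def dagLen [Fintype V] (E : V → V → Prop) (c : V → ℝ) : ℝ :=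
  sSup { x : ℝ | ∃ P : Finset V, IsGenPath E P ∧ x = pathLen c P }

/-- Work left in a vertex started at `s` with execution time `e`, at time `t`. -/
def remainingWork (s e : V → ℝ) (t : ℝ) (v : V) : ℝ := max 0 (min (e v) (s v + e v - t))

/-- A nonempty generalized path of an acyclic finite graph has a first vertex. -/
lemma IsGenPath.exists_first [Finite V] {E : V → V → Prop}
    (hacyc : ∀ v : V, ¬ Relation.TransGen E v v) {Q : Finset V} (hQ : IsGenPath E Q)
    (hne : Q.Nonempty) : ∃ q ∈ Q, ∀ x ∈ Q, x ≠ q → Relation.TransGen E q x := by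
  have : Std.Irrefl (Relation.TransGen E) := ⟨hacyc⟩
  have wf : WellFounded (Relation.TransGen E) := Finite.wellFounded_of_trans_of_irrefl _
  obtain ⟨q, hq, hmin⟩ := wf.has_min (Q : Set V) hne
  refine ⟨q, hq, fun x hx hxq => ?_⟩
  rcases hQ q hq x hx hxq.symm with h | h
  · exact h
  · exact absurd h (hmin x hx)

/-- The vertices of color at most `j` form generalized paths, one for each color. -/
def IsPathColoring (E : V → V → Prop) (j : ℕ) (col : V → ℕ) : Prop :=
  ∀ u v, col u = col v → col u ≤ j → u ≠ v → Relation.TransGen E u v ∨ Relation.TransGen E v u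

/-- Rerouting a path list along a generalized path `Q`: its first vertex `u` becomes covered, and
the uncovered weight grows at most by the amount by which `Q` falls short of the maximum length. -/
lemma IsPathColoring.exists_reroute [Fintype V] {E : V → V → Prop}
    (hacyc : ∀ v : V, ¬ Relation.TransGen E v v) {j : ℕ} {col : V → ℕ}
    (hcol : IsPathColoring E j col) {w : V → ℝ} {L : ℝ}
    (hL : ∀ Q, IsGenPath E Q → pathLen w Q ≤ L) {Q : Finset V} (hQ : IsGenPath E Q)
    {u : V} (hu : u ∈ Q) (hfirst : ∀ x ∈ Q, x ≠ u → Relation.TransGen E u x) :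
    ∃ col' : V → ℕ, IsPathColoring E j col' ∧ col' u ≤ j ∧
      ∑ v with j < col' v, w v ≤ ∑ v with j < col v, w v + (L - pathLen w Q) := by
  classical
  obtain ⟨i, B, D, hi, hB, hD, hQD, hdisj, hnew, huB⟩ : ∃ (i : ℕ) (B D : Finset V), i ≤ j ∧
      (∀ v ∈ B, v ∈ Q ∧ j < col v) ∧ (∀ v ∈ D, col v = i) ∧ IsGenPath E (D ∪ (Q \ B)) ∧
      Disjoint D (Q \ B) ∧
      (∀ x ∈ B, ∀ y, col y = i → y ∉ D → Relation.TransGen E x y) ∧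
      (u ∈ B ∨ (col u ≤ j ∧ u ∉ D)) := by
    by_cases hne : (Q.filter fun v => col v ≤ j).Nonempty
    · have hQf : IsGenPath E (Q.filter fun v => col v ≤ j) := fun a ha b hb =>
        hQ a (Finset.mem_filter.1 ha).1 b (Finset.mem_filter.1 hb).1
      obtain ⟨q, hq, hqmin⟩ := hQf.exists_first hacyc hne
      obtain ⟨hqQ, hqj⟩ := Finset.mem_filter.1 hq
      have hbelow : ∀ v ∈ Q, ¬ Relation.TransGen E v q → v = q ∨ Relation.TransGen E q v := by
        intro v hv hvq
        by_cases h : v = q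
        · exact Or.inl h
        · exact Or.inr ((hQ v hv q hqQ h).resolve_left hvq)
      refine ⟨col q, Q.filter fun v => Relation.TransGen E v q,
        Finset.univ.filter fun v => col v = col q ∧ Relation.TransGen E v q, hqj,
        ?_, ?_, ?_, ?_, ?_, ?_⟩
      · intro v hv
        obtain ⟨hvQ, hvq⟩ := Finset.mem_filter.1 hv
        refine ⟨hvQ, not_le.1 fun hvj => ?_⟩
        by_cases h : v = q
        · exact hacyc q (h ▸ hvq)
        · exact hacyc q ((hqmin v (Finset.mem_filter.2 ⟨hvQ, hvj⟩) h).trans hvq)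
      · intro v hv
        exact (Finset.mem_filter.1 hv).2.1
      · intro a ha b hb hab
        simp only [Finset.mem_union, Finset.mem_filter, Finset.mem_univ, true_and,
          Finset.mem_sdiff, not_and] at ha hb
        rcases ha with ⟨ha, haq⟩ | ⟨ha, haq⟩ <;> rcases hb with ⟨hb, hbq⟩ | ⟨hb, hbq⟩
        · exact hcol a b (ha.trans hb.symm) (ha.le.trans hqj) hab
        · rcases hbelow b hb (hbq hb) with rfl | h
          · exact Or.inl haq
          · exact Or.inl (haq.trans h)
        · rcases hbelow a ha (haq ha) with rfl | h
          · exact Or.inr hbq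
          · exact Or.inr (hbq.trans h)
        · exact hQ a ha b hb hab
      · rw [Finset.disjoint_left]
        intro a ha hb
        simp only [Finset.mem_filter, Finset.mem_univ, true_and,
          Finset.mem_sdiff, not_and] at ha hb
        exact hb.2 hb.1 ha.2
      · intro x hx y hy hyD
        have hxq := (Finset.mem_filter.1 hx).2
        by_cases h : y = q
        · exact h ▸ hxq
        · rcases hcol y q hy (hy.le.trans hqj) h with h' | h'
          · exact absurd (Finset.mem_filter.2 ⟨Finset.mem_univ _, hy, h'⟩) hyD
          · exact hxq.trans h'
      · by_cases h : q = u
        · subst h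
          exact Or.inr ⟨hqj, fun h => hacyc q (Finset.mem_filter.1 h).2.2⟩
        · exact Or.inl (Finset.mem_filter.2 ⟨hu, hfirst q hqQ h⟩)
    · have hun : ∀ v ∈ Q, j < col v := fun v hv => not_le.1 fun h =>
        hne ⟨v, Finset.mem_filter.2 ⟨hv, h⟩⟩
      refine ⟨0, Q, Finset.univ.filter fun v => col v = 0, Nat.zero_le _,
        fun v hv => ⟨hv, hun v hv⟩, by simp, ?_, by simp, ?_, Or.inl hu⟩
      · intro a ha b hb hab
        simp only [Finset.sdiff_self, Finset.union_empty, Finset.mem_filter, Finset.mem_univ,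
          true_and] at ha hb
        exact hcol a b (ha.trans hb.symm) (by omega) hab
      · intro x _ y hy hyD
        simp [hy] at hyD
  have hlen := hL _ hQD
  unfold pathLen at hlen ⊢
  rw [Finset.sum_union hdisj] at hlen
  have hBQ : B ⊆ Q := fun v hv => (hB v hv).1
  have hsplit := Finset.sum_sdiff (f := w) hBQ
  refine ⟨fun v => if v ∈ B then i else if v ∈ D then j + 1 else col v, ?_, ?_, ?_⟩
  · intro a b hab haj hne
    simp only at hab haj
    by_cases ha : a ∈ B <;> by_cases hb : b ∈ B
    · exact hQ a (hBQ ha) b (hBQ hb) hne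
    · by_cases hbD : b ∈ D
      · simp only [ha, hb, hbD, if_true, if_false] at hab; omega
      · simp only [ha, hb, hbD, if_true, if_false] at hab
        exact Or.inl (hnew a ha b hab.symm hbD)
    · by_cases haD : a ∈ D
      · simp only [ha, hb, haD, if_true, if_false] at hab; omega
      · simp only [ha, hb, haD, if_true, if_false] at hab
        exact Or.inr (hnew b hb a hab haD)
    · by_cases haD : a ∈ D
      · simp only [ha, haD, if_true, if_false] at haj; omega
      · by_cases hbD : b ∈ D
        · simp only [ha, hb, haD, hbD, if_true, if_false] at hab haj; omega
        · simp only [ha, hb, haD, hbD, if_false] at hab haj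
          exact hcol a b hab haj hne
  · rcases huB with h | ⟨h, h'⟩
    · simpa [h] using hi
    · by_cases hb : u ∈ B
      · simpa [hb] using hi
      · simpa [hb, h'] using h
  · have hsets : (Finset.univ.filter fun v =>
        j < if v ∈ B then i else if v ∈ D then j + 1 else col v) =
        ((Finset.univ.filter fun v => j < col v) \ B) ∪ D := by
      ext v
      simp only [Finset.mem_filter, Finset.mem_univ, true_and, Finset.mem_union,
        Finset.mem_sdiff]
      have h1 := hB v
      have h2 := hD v
      by_cases hb : v ∈ B <;> by_cases hd : v ∈ D <;> simp [hb, hd] at h1 h2 ⊢ <;> omega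
    have hdisj' : Disjoint ((Finset.univ.filter fun v => j < col v) \ B) D := by
      rw [Finset.disjoint_left]
      intro v hv hd
      have := hD v hd
      simp only [Finset.mem_filter, Finset.mem_univ, true_and, Finset.mem_sdiff] at hv
      omega
    have hsplit' := Finset.sum_sdiff (f := w)
      (show B ⊆ Finset.univ.filter fun v => j < col v from fun v hv => by simpa using (hB v hv).2)
    rw [hsets, Finset.sum_union hdisj']
    linarith

/-- An antichain meets the covered part of a path coloring in at most `j` vertices besides `u`. -/
lemma IsPathColoring.card_le_card_uncovered {E : V → V → Prop} {j : ℕ} {col : V → ℕ}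
    (hcol : IsPathColoring E j col) {A : Finset V} {u : V} (huA : u ∉ A) (hu : col u ≤ j)
    (hAA : ∀ a ∈ A, ∀ b ∈ A, ¬ Relation.TransGen E a b)
    (hAu : ∀ a ∈ A, ¬ Relation.TransGen E a u ∧ ¬ Relation.TransGen E u a) :
    A.card ≤ (A.filter fun v => j < col v).card + j := by
  classical
  have hcov : (A.filter fun v => ¬ j < col v).card ≤ ((Finset.range (j + 1)).erase (col u)).card := by
    refine Finset.card_le_card_of_injOn col ?_ ?_
    · intro a ha
      obtain ⟨haA, haj⟩ := Finset.mem_filter.1 ha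
      refine Finset.mem_coe.2 (Finset.mem_erase.2 ⟨fun h => ?_, Finset.mem_range.2 (by omega)⟩)
      rcases hcol a u h (by omega) (fun h => huA (h ▸ haA)) with h | h
      · exact (hAu a haA).1 h
      · exact (hAu a haA).2 h
    · intro a ha b hb hab
      obtain ⟨haA, haj⟩ := Finset.mem_filter.1 ha
      obtain ⟨hbA, hbj⟩ := Finset.mem_filter.1 hb
      by_contra hne
      rcases hcol a b hab (by omega) hne with h | h
      · exact hAA a haA b hbA h
      · exact hAA b hbA a haA h
  rw [Finset.card_erase_of_mem (Finset.mem_range.2 (by omega)), Finset.card_range] at hcov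
  have := Finset.card_filter_add_card_filter_not (s := A) (fun v => j < col v)
  omega

lemma finish_le_start_of_transGen {E : V → V → Prop} {s e : V → ℝ} (he0 : ∀ v, 0 ≤ e v)
    (hprec : ∀ u v, E u v → s u + e u ≤ s v) {u v : V} (h : Relation.TransGen E u v) :
    s u + e u ≤ s v := by
  induction h with
  | single h => exact hprec _ _ h
  | @tail b c _ h ih => linarith [hprec _ _ h, he0 b]

/-- Below an unfinished vertex there is an unfinished vertex all of whose predecessors are
finished. -/
lemma exists_unfinished_ready [Finite V] {E : V → V → Prop}
    (hacyc : ∀ v : V, ¬ Relation.TransGen E v v) {f : V → ℝ} {t : ℝ} {q : V} (hq : t < f q) :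
    ∃ u, (u = q ∨ Relation.TransGen E u q) ∧ t < f u ∧ ∀ p, E p u → f p ≤ t := by
  have : Std.Irrefl (Relation.TransGen E) := ⟨hacyc⟩
  have wf : WellFounded (Relation.TransGen E) := Finite.wellFounded_of_trans_of_irrefl _
  obtain ⟨u, ⟨huq, hu⟩, hmin⟩ := wf.has_min
    {u | (u = q ∨ Relation.TransGen E u q) ∧ t < f u} ⟨q, Or.inl rfl, hq⟩
  refine ⟨u, huq, hu, fun p hp => not_lt.1 fun hpt => hmin p ⟨Or.inr ?_, hpt⟩ (.single hp)⟩
  rcases huq with rfl | h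
  · exact .single hp
  · exact .head hp h

/-- A generalized path can be made to start, without losing remaining work, in an unfinished vertex
whose predecessors are all finished. -/
lemma exists_path_from_ready [Fintype V] {E : V → V → Prop}
    (hacyc : ∀ v : V, ¬ Relation.TransGen E v v) {f w : V → ℝ} {t : ℝ}
    (hw : ∀ v, 0 ≤ w v) (hfin : ∀ v, f v ≤ t → w v = 0) {z : V} (hz : t < f z)
    {Q : Finset V} (hQ : IsGenPath E Q) :
    ∃ (Q' : Finset V) (u : V), IsGenPath E Q' ∧ u ∈ Q' ∧
      (∀ x ∈ Q', x ≠ u → Relation.TransGen E u x) ∧ t < f u ∧ (∀ p, E p u → f p ≤ t) ∧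
      pathLen w Q ≤ pathLen w Q' := by
  classical
  obtain ⟨Q₁, hQ₁, hne, hunf, hlen⟩ : ∃ Q₁ : Finset V, IsGenPath E Q₁ ∧ Q₁.Nonempty ∧
      (∀ v ∈ Q₁, t < f v) ∧ pathLen w Q ≤ pathLen w Q₁ := by
    have hsum : pathLen w Q = pathLen w (Q.filter fun v => t < f v) := by
      unfold pathLen
      refine (Finset.sum_filter_of_ne fun v _ hv => ?_).symm
      by_contra h
      exact hv (hfin v (not_lt.1 h))
    by_cases hne : (Q.filter fun v => t < f v).Nonempty
    · exact ⟨_, fun a ha b hb => hQ a (Finset.mem_filter.1 ha).1 b (Finset.mem_filter.1 hb).1,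
        hne, fun v hv => (Finset.mem_filter.1 hv).2, hsum.le⟩
    · refine ⟨{z}, ?_, ⟨z, by simp⟩, by simpa using hz, ?_⟩
      · intro a ha b hb hab
        rw [Finset.mem_singleton] at ha hb
        exact absurd (ha.trans hb.symm) hab
      · rw [hsum, Finset.not_nonempty_iff_eq_empty.1 hne]
        simpa [pathLen] using hw z
  obtain ⟨q, hq, hqmin⟩ := hQ₁.exists_first hacyc hne
  obtain ⟨u, huq, hu, hpred⟩ := exists_unfinished_ready (E := E) hacyc (hunf q hq)
  have hfirst : ∀ x ∈ Q₁, x ≠ u → Relation.TransGen E u x := by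
    intro x hx hxu
    rcases huq with rfl | h
    · exact hqmin x hx hxu
    · by_cases hxq : x = q
      · exact hxq ▸ h
      · exact h.trans (hqmin x hx hxq)
  refine ⟨insert u Q₁, u, ?_, Finset.mem_insert_self _ _, ?_, hu, hpred, hlen.trans ?_⟩
  · intro a ha b hb hab
    rcases Finset.mem_insert.1 ha with rfl | haQ
    · exact Or.inl (hfirst b ((Finset.mem_insert.1 hb).resolve_left hab.symm) hab.symm)
    · rcases Finset.mem_insert.1 hb with rfl | hbQ
      · exact Or.inr (hfirst a haQ hab)
      · exact hQ₁ a haQ b hbQ hab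
  · intro x hx hxu
    exact hfirst x ((Finset.mem_insert.1 hx).resolve_left hxu) hxu
  · exact Finset.sum_le_sum_of_subset_of_nonneg (Finset.subset_insert _ _) fun v _ _ => hw v

/-- From time `t` on, an execution finishes within the longest remaining path plus the remaining
uncovered work divided by `m - j`. -/
lemma finish_le_of_remainingWork [Fintype V] {E : V → V → Prop}
    (hacyc : ∀ v : V, ¬ Relation.TransGen E v v) {m j : ℕ} (hjm : j < m) {s e : V → ℝ}
    (he0 : ∀ v, 0 ≤ e v) (hprec : ∀ u v, E u v → s u + e u ≤ s v)
    (hwc : ∀ t : ℝ, 0 ≤ t →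
      (∃ v : V, t < s v ∧ ∀ u, E u v → s u + e u ≤ t) →
      Set.ncard {v : V | s v ≤ t ∧ t < s v + e v} = m)
    (z : V) (t : ℝ) (ht : 0 ≤ t) (L : ℝ)
    (hL : ∀ Q, IsGenPath E Q → pathLen (remainingWork s e t) Q ≤ L)
    (col : V → ℕ) (hcol : IsPathColoring E j col) :
    s z + e z - t ≤ L + (∑ v with j < col v, remainingWork s e t v) / ((m : ℝ) - j) := by
  classical
  have hmj : (1 : ℝ) ≤ (m : ℝ) - j := by
    have : ((j + 1 : ℕ) : ℝ) ≤ m := by exact_mod_cast hjm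
    push_cast at this
    linarith
  have hr0 : ∀ t v, 0 ≤ remainingWork s e t v := fun t v => le_max_left _ _
  have hrfin : ∀ t v, s v + e v ≤ t → remainingWork s e t v = 0 := fun t v h =>
    max_eq_left ((min_le_right _ _).trans (by linarith))
  let events : Finset ℝ := Finset.univ.image s ∪ Finset.univ.image fun v => s v + e v
  induction hn : (events.filter (t < ·)).card using Nat.strong_induction_on
    generalizing t L col with
  | _ n ih =>
  have hL0 : 0 ≤ L := by simpa [pathLen] using hL ∅ (by simp [IsGenPath])
  by_cases hz : s z + e z ≤ t
  · have : 0 ≤ (∑ v with j < col v, remainingWork s e t v) / ((m : ℝ) - j) :=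
      div_nonneg (Finset.sum_nonneg fun v _ => hr0 t v) (by linarith)
    linarith
  rw [not_le] at hz
  have hne : (events.filter (t < ·)).Nonempty := ⟨s z + e z, by simp [events, hz]⟩
  obtain ⟨t', ht'mem, ht'min⟩ := Finset.exists_min_image _ id hne
  simp only [id] at ht'min
  have htt' : t < t' := (Finset.mem_filter.1 ht'mem).2
  have hsnext : ∀ v, t < s v → t' ≤ s v := fun v h => ht'min _ (by simp [events, h])
  have hfnext : ∀ v, t < s v + e v → t' ≤ s v + e v := fun v h => ht'min _ (by simp [events, h])
  have hdecr : (events.filter (t' < ·)).card < n := by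
    rw [← hn]
    refine Finset.card_lt_card ⟨fun x hx => ?_, fun h => ?_⟩
    · obtain ⟨h1, h2⟩ := Finset.mem_filter.1 hx
      exact Finset.mem_filter.2 ⟨h1, htt'.trans h2⟩
    · exact lt_irrefl _ (Finset.mem_filter.1 (h ht'mem)).2
  set A : Finset V := Finset.univ.filter fun v => s v ≤ t ∧ t < s v + e v with hA
  have hmemA : ∀ v, v ∈ A ↔ s v ≤ t ∧ t < s v + e v := fun v => by simp [hA]
  have hrA : ∀ v ∈ A, remainingWork s e t v = remainingWork s e t' v + (t' - t) := by
    intro v hv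
    obtain ⟨h1, h2⟩ := (hmemA v).1 hv
    have h3 := hfnext v h2
    unfold remainingWork
    rw [min_eq_right (by linarith), min_eq_right (by linarith), max_eq_right (by linarith),
      max_eq_right (by linarith)]
    ring
  have hrnA : ∀ v ∉ A, remainingWork s e t v = remainingWork s e t' v := by
    intro v hv
    by_cases h : s v + e v ≤ t
    · rw [hrfin t v h, hrfin t' v (h.trans htt'.le)]
    · have h1 : t < s v := by
        by_contra h1
        exact hv ((hmemA v).2 ⟨not_lt.1 h1, not_le.1 h⟩)
      have h2 := hsnext v h1
      unfold remainingWork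
      rw [min_eq_left (by linarith), min_eq_left (by linarith)]
  have hrmono : ∀ v, remainingWork s e t' v ≤ remainingWork s e t v := by
    intro v
    by_cases hv : v ∈ A
    · linarith [hrA v hv]
    · exact (hrnA v hv).ge
  obtain ⟨Q₀, hQ₀mem, hQ₀max⟩ := Finset.exists_max_image
    (Finset.univ.filter fun Q : Finset V => IsGenPath E Q) (pathLen (remainingWork s e t'))
    ⟨∅, Finset.mem_filter.2 ⟨Finset.mem_univ _, by simp [IsGenPath]⟩⟩
  have hQ₀ : IsGenPath E Q₀ := (Finset.mem_filter.1 hQ₀mem).2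
  have hL' : ∀ Q, IsGenPath E Q →
      pathLen (remainingWork s e t') Q ≤ pathLen (remainingWork s e t') Q₀ := fun Q hQ =>
    hQ₀max Q (by simpa using hQ)
  obtain ⟨Q, u, hQ, huQ, hfirst, hut, hpred, hlen⟩ := exists_path_from_ready hacyc
    (f := fun v => s v + e v) (hr0 t') (fun v h => hrfin t' v (h.trans htt'.le)) hz hQ₀
  have hQL := hL Q hQ
  by_cases hmeet : ∃ a ∈ Q, a ∈ A
  · obtain ⟨a, haQ, haA⟩ := hmeet
    have hstep : pathLen (remainingWork s e t') Q + (t' - t) ≤ pathLen (remainingWork s e t) Q := by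
      unfold pathLen
      rw [← Finset.add_sum_erase _ _ haQ, ← Finset.add_sum_erase Q (remainingWork s e t) haQ,
        hrA a haA]
      linarith [Finset.sum_le_sum fun v (_ : v ∈ Q.erase a) => hrmono v]
    have hrec := ih _ hdecr t' (ht.trans htt'.le) _ hL' col hcol rfl
    have : (∑ v with j < col v, remainingWork s e t' v) / ((m : ℝ) - j) ≤
        (∑ v with j < col v, remainingWork s e t v) / ((m : ℝ) - j) :=
      div_le_div_of_nonneg_right (Finset.sum_le_sum fun v _ => hrmono v) (by linarith)
    linarith
  · have hQA : ∀ a ∈ Q, a ∉ A := fun a ha haA => hmeet ⟨a, ha, haA⟩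
    have huA := hQA u huQ
    have hus : t < s u := by
      by_contra h
      exact huA ((hmemA u).2 ⟨not_lt.1 h, hut⟩)
    have hcard : A.card = m := by
      rw [← hwc t ht ⟨u, hus, hpred⟩, ← Set.ncard_coe_finset]
      congr 1
      ext v
      simp [hA]
    have hlen_eq : pathLen (remainingWork s e t) Q = pathLen (remainingWork s e t') Q :=
      Finset.sum_congr rfl fun v hv => hrnA v (hQA v hv)
    obtain ⟨col', hcol', hu', hsum⟩ := hcol.exists_reroute hacyc hL hQ huQ hfirst
    have hunc := hcol'.card_le_card_uncovered (A := A) huA hu'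
      (fun a ha b hb h => by
        have := finish_le_start_of_transGen he0 hprec h
        linarith [((hmemA a).1 ha).2, ((hmemA b).1 hb).1])
      (fun a ha => ⟨fun h => by
        obtain ⟨p, hap, hpu⟩ := Relation.TransGen.tail'_iff.1 h
        have hp := hpred p hpu
        have ha' := ((hmemA a).1 ha).2
        rcases Relation.reflTransGen_iff_eq_or_transGen.1 hap with rfl | h'
        · linarith
        · linarith [finish_le_start_of_transGen he0 hprec h', he0 p],
        fun h => by
        have := finish_le_start_of_transGen he0 hprec h
        linarith [((hmemA a).1 ha).1]⟩)
    have hdrop : ∑ v with j < col' v, remainingWork s e t v =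
        ∑ v with j < col' v, remainingWork s e t' v +
          ((A.filter fun v => j < col' v).card : ℝ) * (t' - t) := by
      have hv : ∀ v, remainingWork s e t v =
          remainingWork s e t' v + if v ∈ A then t' - t else 0 := by
        intro v
        by_cases hv : v ∈ A
        · simp [hv, hrA v hv]
        · simp [hv, hrnA v hv]
      rw [Finset.sum_congr rfl fun v _ => hv v, Finset.sum_add_distrib, ← Finset.sum_filter,
        Finset.sum_const, nsmul_eq_mul]
      congr 4
      ext v
      simp [and_comm]
    have hunc' : (m : ℝ) - j ≤ ((A.filter fun v => j < col' v).card : ℝ) := by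
      rw [hcard] at hunc
      have : (m : ℝ) ≤ ((A.filter fun v => j < col' v).card : ℝ) + j := by exact_mod_cast hunc
      linarith
    have hrec := ih _ hdecr t' (ht.trans htt'.le) _ hL' col' hcol' rfl
    have hmul := mul_le_mul_of_nonneg_right hunc' (sub_nonneg.2 htt'.le)
    have hgap : 0 ≤ L - pathLen (remainingWork s e t) Q := sub_nonneg.2 hQL
    have hdiv : (∑ v with j < col' v, remainingWork s e t' v) / ((m : ℝ) - j) ≤
        (∑ v with j < col v, remainingWork s e t v) / ((m : ℝ) - j) +
          (L - pathLen (remainingWork s e t) Q) - (t' - t) := by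
      rw [div_le_iff₀ (by linarith), sub_mul, add_mul, div_mul_cancel₀ _ (by linarith)]
      nlinarith
    linarith

lemma pathLen_le_dagLen [Fintype V] {E : V → V → Prop} {c : V → ℝ} {Q : Finset V}
    (hQ : IsGenPath E Q) : pathLen c Q ≤ dagLen E c := by
  refine le_csSup (Set.Finite.bddAbove ?_) ⟨Q, hQ, rfl⟩
  refine (Set.finite_range (pathLen c)).subset ?_
  rintro x ⟨Q', -, rfl⟩
  exact ⟨Q', rfl⟩

theorem multi_path_response_time_bound
    [Fintype V] [Nonempty V]
    (E : V → V → Prop) (hacyc : ∀ v : V, ¬ Relation.TransGen E v v)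
    (c : V → ℝ) (hc : ∀ v, 0 ≤ c v)
    (m : ℕ) (hm : 1 ≤ m)
    (k : ℕ) (hk : k ≤ m - 1)
    -- generalized path list (P_i)_{i=0}^{k}
    (P : ℕ → Finset V)
    (hP : ∀ i ≤ k, IsGenPath E (P i))
    (hPdisj : ∀ i ≤ k, ∀ i' ≤ k, i ≠ i' → Disjoint (P i) (P i'))
    -- an execution sequence of G on m cores
    (s e : V → ℝ)
    (hs : ∀ v, 0 ≤ s v)
    (he0 : ∀ v, 0 ≤ e v) (hec : ∀ v, e v ≤ c v)
    (hprec : ∀ u v, E u v → s u + e u ≤ s v)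
    (hcore : ∀ t : ℝ, Set.ncard {v : V | s v ≤ t ∧ t < s v + e v} ≤ m)
    (hwc : ∀ t : ℝ, 0 ≤ t →
      (∃ v : V, t < s v ∧ ∀ u, E u v → s u + e u ≤ t) →
      Set.ncard {v : V | s v ≤ t ∧ t < s v + e v} = m) :
    -- R ≤ min_{0 ≤ j ≤ k} [ len(G) + (vol(G) − Σ_{i=0}^{j} len(P_i)) / (m − j) ]
    Finset.univ.sup' Finset.univ_nonempty (fun v => s v + e v) ≤
      sInf { x : ℝ | ∃ j ≤ k,
        x = dagLen E c +
          (dagVol c - ∑ i ∈ Finset.range (j + 1), pathLen c (P i)) / ((m : ℝ) - j) } := by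
  classical
  refine le_csInf ⟨_, 0, Nat.zero_le k, rfl⟩ ?_
  rintro x ⟨j, hj, rfl⟩
  refine Finset.sup'_le _ _ fun z _ => ?_
  have hr : ∀ v, remainingWork s e 0 v ≤ c v := fun v =>
    max_le (hc v) ((min_le_left _ _).trans (hec v))
  let col : V → ℕ := fun v =>
    if h : ∃ i, i ≤ j ∧ v ∈ P i then h.choose else j + 1
  have hcolmem : ∀ v, col v ≤ j → v ∈ P (col v) := by
    intro v hv
    by_cases h : ∃ i, i ≤ j ∧ v ∈ P i
    · simpa [col, h] using h.choose_spec.2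
    · simp [col, h] at hv
  have hcol : IsPathColoring E j col := by
    intro a b hab ha hne
    exact hP (col a) (ha.trans hj) a (hcolmem a ha) b (hab ▸ hcolmem b (hab ▸ ha)) hne
  have hbound := finish_le_of_remainingWork hacyc (m := m) (j := j) (by omega) he0 hprec hwc z 0
    le_rfl (dagLen E c)
    (fun Q hQ => (Finset.sum_le_sum fun v _ => hr v).trans (pathLen_le_dagLen hQ)) col hcol
  have hcov : ∑ i ∈ Finset.range (j + 1), pathLen c (P i) = ∑ v with ¬ j < col v, c v := by
    unfold pathLen
    rw [← Finset.sum_biUnion]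
    · refine Finset.sum_congr ?_ fun _ _ => rfl
      ext v
      simp only [Finset.mem_biUnion, Finset.mem_range, Finset.mem_filter, Finset.mem_univ,
        true_and, not_lt]
      constructor
      · rintro ⟨i, hi, hv⟩
        have h : ∃ i, i ≤ j ∧ v ∈ P i := ⟨i, by omega, hv⟩
        simpa [col, h] using h.choose_spec.1
      · exact fun hv => ⟨col v, by omega, hcolmem v hv⟩
    · intro a ha b hb hab
      simp only [Finset.coe_range, Set.mem_Iio] at ha hb
      exact hPdisj a (by omega) b (by omega) hab
  have hvol : dagVol c = ∑ v with j < col v, c v + ∑ v with ¬ j < col v, c v :=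
    (Finset.sum_filter_add_sum_filter_not _ _ _).symm
  have hpos : (0 : ℝ) ≤ (m : ℝ) - j := by
    have : (j : ℝ) ≤ m := by exact_mod_cast (by omega : j ≤ m)
    linarith
  have hmono : (∑ v with j < col v, remainingWork s e 0 v) / ((m : ℝ) - j) ≤
      (dagVol c - ∑ i ∈ Finset.range (j + 1), pathLen c (P i)) / ((m : ℝ) - j) := by
    refine div_le_div_of_nonneg_right ?_ hpos
    rw [hvol, hcov, add_sub_cancel_right]
    exact Finset.sum_le_sum fun v _ => hr v
  linarith
end
end

section
/- Theorem 9 (self-sustainability of the optimal multi-path bound). Let (V, E) be a finite directed acyclic graph and let c, c' : V → ℝ be two weight functions with 0 ≤ c'(v) ≤ c(v) for all v ∈ V. Let G denote the DAG task with weights c and G' the DAG task with weights c'. Then for every integer m ≥ 1, B(G', m) ≤ B(G, m), where len, vol and W_j in the definition of B are computed with respect to the corresponding weight function. -/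
/-! STATEMENT 6: Theorem 9 (self-sustainability of the optimal multi-path bound). -/

noncomputable section

variable {V : Type*}

/-- `W_j(G)`: the maximum total weight of a family of `j+1` pairwise disjoint
generalized paths (paths are allowed to be empty). -/
def Wopt [Fintype V] (E : V → V → Prop) (c : V → ℝ) (j : ℕ) : ℝ :=
  sSup { x : ℝ | ∃ P : ℕ → Finset V,
    (∀ i ≤ j, IsGenPath E (P i)) ∧
    (∀ i ≤ j, ∀ i' ≤ j, i ≠ i' → Disjoint (P i) (P i')) ∧
    x = ∑ i ∈ Finset.range (j + 1), pathLen c (P i) }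

/-- The optimal multi-path bound
`B(G, m) := min_{0 ≤ j ≤ m−1} [ len(G) + (vol(G) − W_j(G)) / (m − j) ]`. -/
def Bopt [Fintype V] (E : V → V → Prop) (c : V → ℝ) (m : ℕ) : ℝ :=
  sInf { x : ℝ | ∃ j < m,
    x = dagLen E c + (dagVol c - Wopt E c j) / ((m : ℝ) - j) }

/-- Pairwise disjoint vertex sets carry at most the total weight of the graph. -/
theorem sum_pathLen_le_dagVol [Fintype V] {d : V → ℝ} (hd : ∀ v, 0 ≤ d v) {j : ℕ}
    {P : ℕ → Finset V} (hP : ∀ i ≤ j, ∀ i' ≤ j, i ≠ i' → Disjoint (P i) (P i')) :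
    ∑ i ∈ Finset.range (j + 1), pathLen d (P i) ≤ dagVol d := by
  classical
  have hdisj : Set.PairwiseDisjoint (Finset.range (j + 1) : Set ℕ) P := by
    intro i hi i' hi' hne
    simp only [Finset.coe_range, Set.mem_Iio] at hi hi'
    exact hP i (by omega) i' (by omega) hne
  unfold pathLen dagVol
  rw [← Finset.sum_biUnion hdisj]
  exact Finset.sum_le_univ_sum_of_nonneg hd

theorem dagLen_mono [Fintype V] (E : V → V → Prop) {c c' : V → ℝ} (hcc : ∀ v, c' v ≤ c v) :
    dagLen E c' ≤ dagLen E c := by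
  have hbdd : BddAbove { x : ℝ | ∃ P : Finset V, IsGenPath E P ∧ x = pathLen c P } := by
    refine ((Set.finite_range (pathLen c)).subset ?_).bddAbove
    rintro x ⟨P, -, rfl⟩
    exact ⟨P, rfl⟩
  refine csSup_le ⟨_, ∅, by simp [IsGenPath], rfl⟩ ?_
  rintro x ⟨P, hP, rfl⟩
  exact (Finset.sum_le_sum fun v _ => hcc v).trans (le_csSup hbdd ⟨P, hP, rfl⟩)

/-- The minimum weight left uncovered by `j + 1` disjoint generalized paths is monotone in the
weights. -/
theorem dagVol_sub_Wopt_mono [Fintype V] (E : V → V → Prop) {c c' : V → ℝ}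
    (hc' : ∀ v, 0 ≤ c' v) (hcc : ∀ v, c' v ≤ c v) (j : ℕ) :
    dagVol c' - Wopt E c' j ≤ dagVol c - Wopt E c j := by
  suffices h : Wopt E c j ≤ Wopt E c' j + (dagVol c - dagVol c') by linarith
  refine csSup_le ⟨_, fun _ => ∅, by simp [IsGenPath], by simp, rfl⟩ ?_
  rintro x ⟨P, hP, hdisj, rfl⟩
  have hW : ∑ i ∈ Finset.range (j + 1), pathLen c' (P i) ≤ Wopt E c' j := by
    refine le_csSup ⟨dagVol c', ?_⟩ ⟨P, hP, hdisj, rfl⟩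
    rintro x ⟨Q, -, hQ, rfl⟩
    exact sum_pathLen_le_dagVol hc' hQ
  have hdiff := sum_pathLen_le_dagVol (d := fun v => c v - c' v)
    (fun v => sub_nonneg.2 (hcc v)) hdisj
  simp only [pathLen, dagVol, Finset.sum_sub_distrib] at hdiff hW ⊢
  linarith

theorem Bopt_self_sustainable
    [Fintype V] [Nonempty V]
    (E : V → V → Prop) (hacyc : ∀ v : V, ¬ Relation.TransGen E v v)
    (c c' : V → ℝ) (hc' : ∀ v, 0 ≤ c' v) (hcc : ∀ v, c' v ≤ c v)
    (m : ℕ) (hm : 1 ≤ m) :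
    Bopt E c' m ≤ Bopt E c m := by
  refine le_csInf ⟨_, 0, hm, rfl⟩ ?_
  rintro x ⟨j, hj, rfl⟩
  have hbdd : BddBelow { x : ℝ | ∃ j < m,
      x = dagLen E c' + (dagVol c' - Wopt E c' j) / ((m : ℝ) - j) } := by
    refine (((Set.finite_Iio m).image fun j : ℕ =>
      dagLen E c' + (dagVol c' - Wopt E c' j) / ((m : ℝ) - j)).subset ?_).bddBelow
    rintro x ⟨i, hi, rfl⟩
    exact ⟨i, hi, rfl⟩
  have hpos : (0 : ℝ) ≤ (m : ℝ) - j := sub_nonneg.2 (by exact_mod_cast hj.le)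
  exact (csInf_le hbdd ⟨j, hj, rfl⟩).trans (add_le_add (dagLen_mono E hcc)
    (div_le_div_of_nonneg_right (dagVol_sub_Wopt_mono E hc' hcc j) hpos))
end
end

section
/- Key inequality (17) in the proof of Theorem 9. Let (V, E) be a finite directed acyclic graph and let c, c' : V → ℝ be weight functions with 0 ≤ c'(v) ≤ c(v) for all v ∈ V. Fix an integer n ≥ 1. Let V₀ ⊆ V be the union of the paths of a generalized path list of cardinality n whose total c-weight is maximum among all generalized path lists of cardinality n, and let V₁ ⊆ V be the union of the paths of a generalized path list of cardinality n whose total c'-weight is maximum among all generalized path lists of cardinality n. Then Σ_{v ∈ V} c(v) − Σ_{v ∈ V₀} c(v) ≥ Σ_{v ∈ V} c'(v) − Σ_{v ∈ V₁} c'(v). -/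
/-! STATEMENT 7: Key inequality (17) in the proof of Theorem 9. -/

noncomputable section

variable {V : Type*}

/-- `P` (indexed over `i < n`) is a generalized path list of cardinality `n`:
`n` pairwise disjoint generalized paths (paths are allowed to be empty). -/
def IsGenPathList (E : V → V → Prop) (n : ℕ) (P : ℕ → Finset V) : Prop :=
  (∀ i < n, IsGenPath E (P i)) ∧
  (∀ i < n, ∀ i' < n, i ≠ i' → Disjoint (P i) (P i'))

theorem key_inequality_thm9
    [Fintype V] [Nonempty V] [DecidableEq V]
    (E : V → V → Prop) (hacyc : ∀ v : V, ¬ Relation.TransGen E v v)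
    (c c' : V → ℝ) (hc' : ∀ v, 0 ≤ c' v) (hcc : ∀ v, c' v ≤ c v)
    (n : ℕ) (hn : 1 ≤ n)
    -- a generalized path list of cardinality n of maximum total c-weight
    (P : ℕ → Finset V) (hP : IsGenPathList E n P)
    (hPmax : ∀ Q : ℕ → Finset V, IsGenPathList E n Q →
      ∑ i ∈ Finset.range n, pathLen c (Q i) ≤ ∑ i ∈ Finset.range n, pathLen c (P i))
    -- a generalized path list of cardinality n of maximum total c'-weight
    (P' : ℕ → Finset V) (hP' : IsGenPathList E n P')
    (hP'max : ∀ Q : ℕ → Finset V, IsGenPathList E n Q →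
      ∑ i ∈ Finset.range n, pathLen c' (Q i) ≤ ∑ i ∈ Finset.range n, pathLen c' (P' i)) :
    -- Σ_{v∈V} c(v) − Σ_{v∈V₀} c(v) ≥ Σ_{v∈V} c'(v) − Σ_{v∈V₁} c'(v)
    (∑ v : V, c v) - ∑ v ∈ (Finset.range n).biUnion P, c v ≥
      (∑ v : V, c' v) - ∑ v ∈ (Finset.range n).biUnion P', c' v := by
  have sum_paths : ∀ Q : ℕ → Finset V, IsGenPathList E n Q →
      ∑ i ∈ Finset.range n, pathLen c' (Q i) = ∑ v ∈ (Finset.range n).biUnion Q, c' v := by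
    intro Q hQ
    refine (Finset.sum_biUnion fun i hi j hj hij => ?_).symm
    exact hQ.2 i (by simpa using hi) j (by simpa using hj) hij
  have hmax := hP'max P hP
  rw [sum_paths P hP, sum_paths P' hP'] at hmax
  have hcompl : ∑ v ∈ ((Finset.range n).biUnion P)ᶜ, c' v ≤
      ∑ v ∈ ((Finset.range n).biUnion P)ᶜ, c v := Finset.sum_le_sum fun v _ => hcc v
  have hsum := Finset.sum_add_sum_compl ((Finset.range n).biUnion P) c
  have hsum' := Finset.sum_add_sum_compl ((Finset.range n).biUnion P) c'
  linarith
end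
end

section
/- Necessity direction of the reduction in Theorem 2. Let G = (V, E) be a DAG task with weight function c, let n ≥ 1 be an integer and X ∈ ℝ. If there exist n pairwise disjoint nonempty generalized paths in G whose total weight is at least X, then in the flow network G' constructed from G there exists a flow f taking only the values 0 and 1, of amount n, and of cost at most −X. -/
/-! STATEMENT 8: Necessity direction of the reduction in Theorem 2. -/

noncomputable section

variable {V : Type*}

/-- The vertex set of the flow network `G'` constructed from `G`:
`Sum.inl true` is the source `σ`, `Sum.inl false` is the sink `τ`,
`Sum.inr (Sum.inl v)` is `v^in` and `Sum.inr (Sum.inr v)` is `v^out`. -/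
abbrev FNode (V : Type*) := Bool ⊕ (V ⊕ V)

def fsrc : FNode V := Sum.inl true
def fsnk : FNode V := Sum.inl false
def fvin (v : V) : FNode V := Sum.inr (Sum.inl v)
def fvout (v : V) : FNode V := Sum.inr (Sum.inr v)

/-- The edge set `E'` of the flow network: `(σ, v^in)` and `(v^out, τ)` for every `v`,
`(v^in, v^out)` for every `v`, and `(u^out, v^in)` whenever `u` is an ancestor of `v`. -/
def FEdge (E : V → V → Prop) : FNode V → FNode V → Prop
  | Sum.inl b, Sum.inr (Sum.inl _) => b = true
  | Sum.inr (Sum.inl v), Sum.inr (Sum.inr w) => v = w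
  | Sum.inr (Sum.inr u), Sum.inr (Sum.inl v) => Relation.TransGen E u v
  | Sum.inr (Sum.inr _), Sum.inl b => b = false
  | _, _ => False

/-- `f` is a flow on the flow network constructed from `(V, E)`: it vanishes outside
the edge set, respects the unit capacities, and is conserved at every vertex other
than the source and the sink. -/
def IsFlow [Fintype V] (E : V → V → Prop) (f : FNode V → FNode V → ℝ) : Prop :=
  (∀ x y, ¬ FEdge E x y → f x y = 0) ∧
  (∀ x y, 0 ≤ f x y ∧ f x y ≤ 1) ∧
  (∀ x : FNode V, x ≠ fsrc → x ≠ fsnk →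
    ∑ y : FNode V, f y x = ∑ y : FNode V, f x y)

/-- The amount of a flow: total flow out of the source. -/
def flowAmount [Fintype V] (f : FNode V → FNode V → ℝ) : ℝ :=
  ∑ v : V, f fsrc (fvin v)

/-- The cost of a flow: each edge `(v^in, v^out)` has cost `−c(v)`, all other
edges have cost `0`. -/
def flowCost [Fintype V] (c : V → ℝ) (f : FNode V → FNode V → ℝ) : ℝ :=
  ∑ v : V, (-(c v)) * f (fvin v) (fvout v)

/-- `v` is the first element of `P` with respect to the relation `r`. -/
def IsFirstIn (r : V → V → Prop) (P : Finset V) (v : V) : Prop :=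
  v ∈ P ∧ ∀ w ∈ P, ¬ r w v

/-- `u` is immediately followed by `v` in `P` with respect to the relation `r`. -/
def IsNextIn (r : V → V → Prop) (P : Finset V) (u v : V) : Prop :=
  u ∈ P ∧ v ∈ P ∧ r u v ∧ ∀ w ∈ P, r u w → ¬ r w v

lemma isNextIn_swap (r : V → V → Prop) (P : Finset V) (u v : V) :
    IsNextIn (Function.swap r) P v u ↔ IsNextIn r P u v := by
  simp only [IsNextIn, Function.swap]
  grind

open scoped Classical in
lemma sum_indicator_of_existsUnique [Fintype V] {p : V → Prop} (h : ∃! v, p v) :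
    ∑ v : V, (if p v then (1 : ℝ) else 0) = 1 := by
  obtain ⟨a, ha, hu⟩ := h
  have hp : ∀ v, p v ↔ v = a := fun v => ⟨hu v, fun e => e ▸ ha⟩
  simp [hp]

section Chain

variable [Fintype V] {r : V → V → Prop} {P : Finset V}

lemma existsUnique_isFirstIn [IsTrans V r] [Std.Irrefl r]
    (hP : ∀ u ∈ P, ∀ v ∈ P, u ≠ v → r u v ∨ r v u) (hne : P.Nonempty) :
    ∃! v, IsFirstIn r P v := by
  obtain ⟨a, ha, hmin⟩ :=
    (Finite.wellFounded_of_trans_of_irrefl r).has_min (P : Set V) hne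
  refine ⟨a, ⟨ha, hmin⟩, fun v hv => ?_⟩
  by_contra hva
  exact (hP v hv.1 a ha hva).elim (hmin v hv.1) (hv.2 a ha)

lemma existsUnique_isNextIn [IsTrans V r] [Std.Irrefl r]
    (hP : ∀ u ∈ P, ∀ v ∈ P, u ≠ v → r u v ∨ r v u) {v : V} (hv : v ∈ P)
    (hnf : ¬ IsFirstIn r P v) : ∃! u, IsNextIn r P u v := by
  have hne : ({w | w ∈ P ∧ r w v} : Set V).Nonempty := by
    simp only [IsFirstIn, not_and, not_forall, not_not] at hnf
    obtain ⟨w, hw, hwv⟩ := hnf hv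
    exact ⟨w, hw, hwv⟩
  obtain ⟨a, ⟨ha, hav⟩, hmax⟩ :=
    (Finite.wellFounded_of_trans_of_irrefl (Function.swap r)).has_min _ hne
  refine ⟨a, ⟨ha, hv, hav, fun w hw haw hwv => hmax w ⟨hw, hwv⟩ haw⟩, fun u hu => ?_⟩
  by_contra hua
  exact (hP u hu.1 a ha hua).elim (fun h => hu.2.2.2 a ha h hav)
    (fun h => hmax u ⟨hu.1, hu.2.2.1⟩ h)

open scoped Classical in
/-- Each element of a chain is either its first element or has exactly one predecessor. -/
lemma first_add_sum_next [IsTrans V r] [Std.Irrefl r]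
    (hP : ∀ u ∈ P, ∀ v ∈ P, u ≠ v → r u v ∨ r v u) (v : V) :
    (if IsFirstIn r P v then (1 : ℝ) else 0) +
      ∑ u : V, (if IsNextIn r P u v then (1 : ℝ) else 0) = if v ∈ P then 1 else 0 := by
  by_cases hv : v ∈ P
  · by_cases hf : IsFirstIn r P v
    · have hn : ∀ u, ¬ IsNextIn r P u v := fun u hu => hf.2 u hu.1 hu.2.2.1
      simp [hv, hf, hn]
    · simp [hv, hf, sum_indicator_of_existsUnique (existsUnique_isNextIn hP hv hf)]
  · have hf : ¬ IsFirstIn r P v := fun h => hv h.1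
    have hn : ∀ u, ¬ IsNextIn r P u v := fun u hu => hv hu.2.1
    simp [hv, hf, hn]

end Chain

/-- The edges of the flow network traversed by the chain `P` of the relation `r`. -/
def PathEdge (r : V → V → Prop) (P : Finset V) : FNode V → FNode V → Prop
  | Sum.inl b, Sum.inr (Sum.inl v) => b = true ∧ IsFirstIn r P v
  | Sum.inr (Sum.inl v), Sum.inr (Sum.inr w) => v = w ∧ v ∈ P
  | Sum.inr (Sum.inr u), Sum.inr (Sum.inl v) => IsNextIn r P u v
  | Sum.inr (Sum.inr v), Sum.inl b => b = false ∧ IsFirstIn (Function.swap r) P v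
  | _, _ => False

open scoped Classical in
/-- The unit flow along the chain `P`. -/
def pathFlow (r : V → V → Prop) (P : Finset V) (x y : FNode V) : ℝ :=
  if PathEdge r P x y then 1 else 0

lemma PathEdge.fEdge {E : V → V → Prop} {P : Finset V} {x y : FNode V}
    (h : PathEdge (Relation.TransGen E) P x y) : FEdge E x y := by
  rcases x with b | v | v <;> rcases y with b' | w | w <;>
    simp_all [PathEdge, FEdge, IsNextIn]

lemma PathEdge.not_disjoint {r : V → V → Prop} {P Q : Finset V} {x y : FNode V}
    (h : PathEdge r P x y) (h' : PathEdge r Q x y) : ¬ Disjoint P Q := by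
  rw [Finset.not_disjoint_iff]
  rcases x with b | v | v <;> rcases y with b' | w | w <;>
    simp only [PathEdge, IsNextIn, IsFirstIn] at h h'
  · exact ⟨w, h.2.1, h'.2.1⟩
  · exact ⟨v, h.2, h'.2⟩
  · exact ⟨v, h.2.1, h'.2.1⟩
  · exact ⟨v, h.1, h'.1⟩

lemma pathFlow_conservation [Fintype V] {r : V → V → Prop} [IsTrans V r] [Std.Irrefl r]
    {P : Finset V} (hP : ∀ u ∈ P, ∀ v ∈ P, u ≠ v → r u v ∨ r v u)
    (x : FNode V) (hsrc : x ≠ fsrc) (hsnk : x ≠ fsnk) :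
    ∑ y, pathFlow r P y x = ∑ y, pathFlow r P x y := by
  classical
  rcases x with b | v | v
  · cases b
    · exact (hsnk rfl).elim
    · exact (hsrc rfl).elim
  · have hout : ∑ w : V, pathFlow r P (Sum.inr (Sum.inl v)) (Sum.inr (Sum.inr w)) =
        if v ∈ P then 1 else 0 := by
      refine (Fintype.sum_eq_single v fun w hw => ?_).trans ?_
      · exact if_neg fun h => hw h.1.symm
      · simp [pathFlow, PathEdge]
    rw [Fintype.sum_sum_type, Fintype.sum_sum_type, Fintype.sum_sum_type, Fintype.sum_sum_type,
      hout, ← first_add_sum_next hP v]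
    simp [pathFlow, PathEdge, -Finset.sum_boole]
    rfl
  · have hP' : ∀ u ∈ P, ∀ w ∈ P, u ≠ w → Function.swap r u w ∨ Function.swap r w u :=
      fun u hu w hw huw => (hP u hu w hw huw).symm
    have hin : ∑ u : V, pathFlow r P (Sum.inr (Sum.inl u)) (Sum.inr (Sum.inr v)) =
        if v ∈ P then 1 else 0 := by
      refine (Fintype.sum_eq_single v fun w hw => ?_).trans ?_
      · exact if_neg fun h => hw h.1
      · simp [pathFlow, PathEdge]
    rw [Fintype.sum_sum_type, Fintype.sum_sum_type, Fintype.sum_sum_type, Fintype.sum_sum_type,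
      hin, ← first_add_sum_next hP' v]
    simp [pathFlow, PathEdge, isNextIn_swap, -Finset.sum_boole]
    rfl

lemma flowAmount_pathFlow [Fintype V] {r : V → V → Prop} [IsTrans V r] [Std.Irrefl r]
    {P : Finset V} (hP : ∀ u ∈ P, ∀ v ∈ P, u ≠ v → r u v ∨ r v u) (hne : P.Nonempty) :
    flowAmount (pathFlow r P) = 1 := by
  classical
  simpa [flowAmount, pathFlow, PathEdge, fsrc, fvin] using
    sum_indicator_of_existsUnique (existsUnique_isFirstIn hP hne)

lemma flowCost_pathFlow [Fintype V] (r : V → V → Prop) (c : V → ℝ) (P : Finset V) :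
    flowCost c (pathFlow r P) = -pathLen c P := by
  classical
  simp [flowCost, pathFlow, PathEdge, fvin, fvout, pathLen]

theorem reduction_necessity
    [Fintype V] [Nonempty V]
    (E : V → V → Prop) (hacyc : ∀ v : V, ¬ Relation.TransGen E v v)
    (c : V → ℝ) (hc : ∀ v, 0 ≤ c v)
    (n : ℕ) (hn : 1 ≤ n) (X : ℝ)
    -- n pairwise disjoint nonempty generalized paths of total weight at least X
    (P : ℕ → Finset V)
    (hP : ∀ i < n, IsGenPath E (P i))
    (hPne : ∀ i < n, (P i).Nonempty)
    (hPdisj : ∀ i < n, ∀ i' < n, i ≠ i' → Disjoint (P i) (P i'))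
    (hX : X ≤ ∑ i ∈ Finset.range n, pathLen c (P i)) :
    -- there is a 0/1-valued flow of amount n and cost at most −X
    ∃ f : FNode V → FNode V → ℝ,
      IsFlow E f ∧
      (∀ x y, f x y = 0 ∨ f x y = 1) ∧
      flowAmount f = (n : ℝ) ∧
      flowCost c f ≤ -X := by
  classical
  have : Std.Irrefl (Relation.TransGen E) := ⟨hacyc⟩
  have : IsTrans V (Relation.TransGen E) := ⟨fun _ _ _ => Relation.TransGen.trans⟩
  let f : FNode V → FNode V → ℝ :=
    fun x y => ∑ i ∈ Finset.range n, pathFlow (Relation.TransGen E) (P i) x y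
  have hf01 : ∀ x y, f x y = 0 ∨ f x y = 1 := by
    intro x y
    by_cases h : ∃ i < n, PathEdge (Relation.TransGen E) (P i) x y
    · obtain ⟨i, hi, hxy⟩ := h
      right
      refine (Finset.sum_eq_single_of_mem i (Finset.mem_range.2 hi) fun j hj hji => ?_).trans
        (if_pos hxy)
      exact if_neg fun hxy' =>
        hxy'.not_disjoint hxy (hPdisj j (Finset.mem_range.1 hj) i hi hji)
    · left
      exact Finset.sum_eq_zero fun i hi => if_neg fun hxy => h ⟨i, Finset.mem_range.1 hi, hxy⟩
  refine ⟨f, ⟨fun x y hxy => ?_, fun x y => ?_, fun x hsrc hsnk => ?_⟩, hf01, ?_, ?_⟩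
  · exact Finset.sum_eq_zero fun i _ => if_neg fun h => hxy h.fEdge
  · rcases hf01 x y with h | h <;> simp [h]
  · simp only [f]
    rw [Finset.sum_comm, Finset.sum_comm (s := Finset.univ)]
    exact Finset.sum_congr rfl fun i hi =>
      pathFlow_conservation (hP i (Finset.mem_range.1 hi)) x hsrc hsnk
  · calc flowAmount f
        = ∑ i ∈ Finset.range n, flowAmount (pathFlow (Relation.TransGen E) (P i)) :=
          Finset.sum_comm
      _ = ∑ _i ∈ Finset.range n, (1 : ℝ) := Finset.sum_congr rfl fun i hi =>
          flowAmount_pathFlow (hP i (Finset.mem_range.1 hi)) (hPne i (Finset.mem_range.1 hi))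
      _ = n := by simp
  · calc flowCost c f
        = ∑ i ∈ Finset.range n, flowCost c (pathFlow (Relation.TransGen E) (P i)) := by
          simp only [flowCost, f, Finset.mul_sum]
          exact Finset.sum_comm
      _ = -∑ i ∈ Finset.range n, pathLen c (P i) := by
          simp [flowCost_pathFlow]
      _ ≤ -X := neg_le_neg hX
end
end

section
/- Sufficiency direction of the reduction in Theorem 2. Let G = (V, E) be a DAG task with weight function c, let n ≥ 1 be an integer and X ∈ ℝ. If in the flow network G' constructed from G there exists a flow f taking only the values 0 and 1, of amount n, and of cost at most −X, then there exist n pairwise disjoint generalized paths in G whose total weight is at least X. -/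
/-! STATEMENT 9: Sufficiency direction of the reduction in Theorem 2. -/

noncomputable section

variable {V : Type*}

/-- A finite nonnegative family with sum at most `1` takes the value `1` at most once. -/
theorem eq_of_sum_le_one {ι : Type*} [Fintype ι] {g : ι → ℝ} (hg : ∀ i, 0 ≤ g i)
    (hsum : ∑ i, g i ≤ 1) {a b : ι} (ha : g a = 1) (hb : g b = 1) : a = b := by
  classical
  by_contra hab
  have h : ∑ i ∈ {a, b}, g i ≤ ∑ i, g i :=
    Finset.sum_le_sum_of_subset_of_nonneg (Finset.subset_univ _) fun i _ _ => hg i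
  rw [Finset.sum_pair hab] at h
  linarith

/-- The total flow into `v^in` is the flow through the edge `(v^in, v^out)`. -/
theorem IsFlow.sum_into_fvin [Fintype V] {E : V → V → Prop} {f : FNode V → FNode V → ℝ}
    (hf : IsFlow E f) (v : V) : ∑ y, f y (fvin v) = f (fvin v) (fvout v) := by
  rw [hf.2.2 (fvin v) (by simp [fvin, fsrc]) (by simp [fvin, fsnk])]
  refine Fintype.sum_eq_single _ fun y hy => hf.1 _ _ ?_
  rcases y with b | w | w
  · simp [fvin, FEdge]
  · simp [fvin, FEdge]
  · rintro rfl
    exact hy rfl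

/-- The total flow out of `v^out` is the flow through the edge `(v^in, v^out)`. -/
theorem IsFlow.sum_out_of_fvout [Fintype V] {E : V → V → Prop} {f : FNode V → FNode V → ℝ}
    (hf : IsFlow E f) (v : V) : ∑ y, f (fvout v) y = f (fvin v) (fvout v) := by
  rw [← hf.2.2 (fvout v) (by simp [fvout, fsrc]) (by simp [fvout, fsnk])]
  refine Fintype.sum_eq_single _ fun y hy => hf.1 _ _ ?_
  rcases y with b | w | w
  · simp [fvout, FEdge]
  · rintro rfl
    exact hy rfl
  · simp [fvout, FEdge]

/-- In a `0/1`-valued flow on an acyclic graph, every vertex carrying flow is reached from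
a vertex fed by the source along edges carrying flow. -/
theorem IsFlow.exists_source_reaches [Fintype V] {E : V → V → Prop}
    {f : FNode V → FNode V → ℝ} (hf : IsFlow E f)
    (hacyc : ∀ v : V, ¬ Relation.TransGen E v v) (hf01 : ∀ x y, f x y = 0 ∨ f x y = 1)
    (v : V) (hv : f (fvin v) (fvout v) = 1) :
    ∃ s, f fsrc (fvin s) = 1 ∧
      Relation.ReflTransGen (fun u w => f (fvout u) (fvin w) = 1) s v := by
  have : Std.Irrefl (Relation.TransGen E) := ⟨hacyc⟩
  have hwf : WellFounded (Relation.TransGen E) := Finite.wellFounded_of_trans_of_irrefl _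
  induction v using hwf.induction with
  | _ v ih =>
    have hsum := (hf.sum_into_fvin v).trans hv
    obtain ⟨y, -, hy⟩ : ∃ y ∈ Finset.univ, f y (fvin v) ≠ 0 :=
      Finset.exists_ne_zero_of_sum_ne_zero (by rw [hsum]; exact one_ne_zero)
    have hy1 : f y (fvin v) = 1 := (hf01 _ _).resolve_left hy
    have hedge : FEdge E y (fvin v) := not_not.mp fun h => hy (hf.1 _ _ h)
    rcases y with b | w | w
    · obtain rfl : b = true := hedge
      exact ⟨v, hy1, .refl⟩
    · exact hedge.elim
    · have hw : f (fvin w) (fvout w) = 1 := by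
        refine (hf01 _ _).resolve_left fun h0 => hy ?_
        have hzero := (hf.sum_out_of_fvout w).trans h0
        exact (Finset.sum_eq_zero_iff_of_nonneg fun i _ => (hf.2.1 _ i).1).mp hzero _
          (Finset.mem_univ (fvin v))
      obtain ⟨s, hs, hsw⟩ := ih w hedge hw
      exact ⟨s, hs, hsw.tail hy1⟩

theorem reduction_sufficiency
    [Fintype V] [Nonempty V]
    (E : V → V → Prop) (hacyc : ∀ v : V, ¬ Relation.TransGen E v v)
    (c : V → ℝ) (hc : ∀ v, 0 ≤ c v)
    (n : ℕ) (hn : 1 ≤ n) (X : ℝ)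
    -- a 0/1-valued flow of amount n and cost at most −X
    (f : FNode V → FNode V → ℝ)
    (hf : IsFlow E f)
    (hf01 : ∀ x y, f x y = 0 ∨ f x y = 1)
    (hamount : flowAmount f = (n : ℝ))
    (hcost : flowCost c f ≤ -X) :
    -- there are n pairwise disjoint generalized paths of total weight at least X
    ∃ P : ℕ → Finset V,
      (∀ i < n, IsGenPath E (P i)) ∧
      (∀ i < n, ∀ i' < n, i ≠ i' → Disjoint (P i) (P i')) ∧
      X ≤ ∑ i ∈ Finset.range n, pathLen c (P i) := by
  classical
  let R : V → V → Prop := fun u w => f (fvout u) (fvin w) = 1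
  have hRE : ∀ {u w}, R u w → Relation.TransGen E u w := fun {u w} h => by
    by_contra hn
    have h0 : f (fvout u) (fvin w) = 0 := hf.1 _ _ hn
    exact zero_ne_one (h0.symm.trans h)
  have hin : ∀ {v x y}, f x (fvin v) = 1 → f y (fvin v) = 1 → x = y := fun {v _ _} hx hy =>
    eq_of_sum_le_one (g := fun x => f x (fvin v)) (fun x => (hf.2.1 x _).1)
      ((hf.sum_into_fvin v).trans_le (hf.2.1 _ _).2) hx hy
  have hout : ∀ {v x y}, f (fvout v) x = 1 → f (fvout v) y = 1 → x = y := fun {v _ _} hx hy =>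
    eq_of_sum_le_one (g := f (fvout v)) (fun x => (hf.2.1 _ x).1)
      ((hf.sum_out_of_fvout v).trans_le (hf.2.1 _ _).2) hx hy
  have hright : Relator.RightUnique R := fun u v w hv hw => by
    simpa [fvin] using hout hv hw
  have hleft : Relator.RightUnique (Function.swap R) := fun u v w hv hw => by
    simpa [fvout] using hin hv hw
  have hroot : ∀ {s s'}, f fsrc (fvin s') = 1 → Relation.ReflTransGen R s s' → s = s' := by
    intro s s' hs' h
    rcases h.cases_tail with h | ⟨u, -, hu⟩
    · exact h.symm
    · exact absurd (hin hs' hu) (by simp [fsrc, fvout])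
  have hdisj : ∀ {s s' v}, f fsrc (fvin s) = 1 → f fsrc (fvin s') = 1 →
      Relation.ReflTransGen R s v → Relation.ReflTransGen R s' v → s = s' := by
    intro s s' v hs hs' h h'
    rcases Relation.ReflTransGen.total_of_right_unique hleft h.swap h'.swap with hh | hh
    · exact (hroot hs hh.swap).symm
    · exact hroot hs' hh.swap
  have hcomp : ∀ {u v}, Relation.ReflTransGen R u v → u ≠ v → Relation.TransGen E u v := by
    intro u v h huv
    rcases Relation.reflTransGen_iff_eq_or_transGen.mp h with h | h
    · exact absurd h.symm huv
    · exact Relation.TransGen.closed (fun _ _ => hRE) _ _ h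
  let S : Finset V := Finset.univ.filter fun s => f fsrc (fvin s) = 1
  have hS : ∀ s : S, f fsrc (fvin s) = 1 := fun s => (Finset.mem_filter.mp s.2).2
  have hcard : S.card = n := by
    have h : flowAmount f = (S.card : ℝ) := by
      rw [flowAmount, Finset.card_filter, Nat.cast_sum]
      refine Finset.sum_congr rfl fun v _ => ?_
      rcases hf01 fsrc (fvin v) with h | h <;> simp [h]
    exact_mod_cast h.symm.trans hamount
  let e : Fin n ≃ S := (S.equivFinOfCardEq hcard).symm
  let Q : V → Finset V := fun s => Finset.univ.filter (Relation.ReflTransGen R s)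
  have hQ : ∀ {s v}, v ∈ Q s ↔ Relation.ReflTransGen R s v := by simp [Q]
  have hQdisj : ∀ i j : Fin n, i ≠ j → Disjoint (Q (e i)) (Q (e j)) := fun i j hij =>
    Finset.disjoint_left.mpr fun v hi hj => hij <| e.injective <| Subtype.ext <|
      hdisj (hS _) (hS _) (hQ.mp hi) (hQ.mp hj)
  refine ⟨fun i => if h : i < n then Q (e ⟨i, h⟩) else ∅, ?_, ?_, ?_⟩
  · intro i hi u hu v hv huv
    simp only [hi, dite_true, hQ] at hu hv
    exact (Relation.ReflTransGen.total_of_right_unique hright hu hv).imp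
      (hcomp · huv) (hcomp · huv.symm)
  · intro i hi j hj hij
    simp only [hi, hj, dite_true]
    exact hQdisj _ _ (by simpa using hij)
  · rw [Finset.sum_range]
    simp only [Fin.is_lt, dite_true, pathLen]
    rw [← Finset.sum_biUnion fun i _ j _ hij => hQdisj i j hij]
    have hA : ∑ v with f (fvin v) (fvout v) = 1, c v = -flowCost c f := by
      rw [flowCost, Finset.sum_filter, ← Finset.sum_neg_distrib]
      refine Finset.sum_congr rfl fun v _ => ?_
      rcases hf01 (fvin v) (fvout v) with h | h <;> simp [h]
    calc X ≤ -flowCost c f := by linarith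
      _ = ∑ v with f (fvin v) (fvout v) = 1, c v := hA.symm
      _ ≤ _ := Finset.sum_le_sum_of_subset_of_nonneg (fun v hv => ?_) fun v _ _ => hc v
    obtain ⟨s, hs, hsv⟩ := hf.exists_source_reaches hacyc hf01 v (Finset.mem_filter.mp hv).2
    refine Finset.mem_biUnion.mpr
      ⟨e.symm ⟨s, Finset.mem_filter.mpr ⟨Finset.mem_univ _, hs⟩⟩, Finset.mem_univ _, ?_⟩
    simpa [hQ] using hsv
end
end

section
/- Sustainability of the optimal multi-path bound with respect to the number of cores. Let G = (V, E) be a DAG task with weight function c and let m, m' be integers with 1 ≤ m ≤ m'. Then B(G, m') ≤ B(G, m), i.e., the optimal multi-path bound does not increase when the number of cores increases. -/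
/-! STATEMENT 10: Sustainability of the optimal multi-path bound with respect to
the number of cores. -/

noncomputable section

variable {V : Type*}

/-- The total weight of disjoint generalized paths never exceeds the volume. -/
theorem Wopt_le_dagVol [Fintype V] (E : V → V → Prop) (c : V → ℝ) (hc : ∀ v, 0 ≤ c v) (j : ℕ) :
    Wopt E c j ≤ dagVol c := by
  classical
  refine Real.sSup_le ?_ (Finset.sum_nonneg fun v _ => hc v)
  rintro x ⟨P, -, hdisj, rfl⟩
  have hpw : Set.PairwiseDisjoint (↑(Finset.range (j + 1))) P := fun i hi i' hi' hne =>
    hdisj i (Finset.mem_range_succ_iff.mp hi) i' (Finset.mem_range_succ_iff.mp hi') hne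
  calc ∑ i ∈ Finset.range (j + 1), pathLen c (P i)
      = ∑ v ∈ (Finset.range (j + 1)).biUnion P, c v := (Finset.sum_biUnion hpw).symm
    _ ≤ dagVol c :=
      Finset.sum_le_sum_of_subset_of_nonneg (Finset.subset_univ _) fun v _ _ => hc v

/-- The set of candidate bounds minimized by `Bopt` is bounded below by `dagLen`. -/
theorem dagLen_mem_lowerBounds [Fintype V] (E : V → V → Prop) (c : V → ℝ)
    (hc : ∀ v, 0 ≤ c v) (m : ℕ) :
    dagLen E c ∈ lowerBounds { x : ℝ | ∃ j < m,
      x = dagLen E c + (dagVol c - Wopt E c j) / ((m : ℝ) - j) } := by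
  rintro x ⟨j, hj, rfl⟩
  have hjm : (j : ℝ) ≤ m := by exact_mod_cast hj.le
  exact le_add_of_nonneg_right
    (div_nonneg (sub_nonneg.mpr (Wopt_le_dagVol E c hc j)) (sub_nonneg.mpr hjm))

theorem Bopt_antitone_in_cores
    [Fintype V] [Nonempty V]
    (E : V → V → Prop) (hacyc : ∀ v : V, ¬ Relation.TransGen E v v)
    (c : V → ℝ) (hc : ∀ v, 0 ≤ c v)
    (m m' : ℕ) (hm : 1 ≤ m) (hmm : m ≤ m') :
    Bopt E c m' ≤ Bopt E c m := by
  refine le_csInf ⟨_, 0, hm, rfl⟩ ?_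
  rintro x ⟨j, hj, rfl⟩
  refine (csInf_le ⟨_, dagLen_mem_lowerBounds E c hc m'⟩ ⟨j, hj.trans_le hmm, rfl⟩).trans ?_
  have hpos : (0 : ℝ) < m - j := sub_pos.mpr (by exact_mod_cast hj)
  have hnonneg : 0 ≤ dagVol c - Wopt E c j := sub_nonneg.mpr (Wopt_le_dagVol E c hc j)
  gcongr
end
end
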